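/- Every finitely generated subgroup H of a finitely generated free group F_N is contained in a unique smallest free factor Fill(H) of F_N: the intersection of all free factors of F_N containing H is itself a free factor containing H. -/

import Mathlib

/-- `A` is a free factor of `B`: `A ≤ B` and there is `K ≤ B` such that `B` is the internal
free product of `A` and `K` (the natural map from the free product `A ∗ K` to `B` is an
isomorphism). -/
def IsFreeFactorOf {G : Type*} [Group G] (A B : Subgroup G) : Prop :=
  ∃ (h : A ≤ B) (K : Subgroup G) (hK : K ≤ B),
    Function.Bijective ⇑(Monoid.Coprod.lift (Subgroup.inclusion h) (Subgroup.inclusion hK))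

open Monoid

namespace IsFreeFactorOf

variable {G : Type*} [Group G]

theorem le_sup_of_surjective_lift {A K B : Subgroup G} (hA : A ≤ B) (hK : K ≤ B)
    (h : Function.Surjective
      (Coprod.lift (Subgroup.inclusion hA) (Subgroup.inclusion hK))) :
    B ≤ A ⊔ K := by
  intro b hb
  obtain ⟨p, hp⟩ := h ⟨b, hb⟩
  have key : ∀ p, ((Coprod.lift (Subgroup.inclusion hA) (Subgroup.inclusion hK) p : B) : G) ∈
      A ⊔ K := by
    intro p
    induction p using Coprod.induction_on with
    | inl a => simpa using Subgroup.mem_sup_left a.2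
    | inr k => simpa using Subgroup.mem_sup_right k.2
    | mul x y hx hy => simpa using mul_mem hx hy
  simpa [hp] using key p

theorem surjective_lift_of_le_sup {A K B : Subgroup G} (hA : A ≤ B) (hK : K ≤ B)
    (h : B ≤ A ⊔ K) :
    Function.Surjective (Coprod.lift (Subgroup.inclusion hA) (Subgroup.inclusion hK)) := by
  rintro ⟨b, hb⟩
  have key : A ⊔ K ≤
      (B.subtype.comp (Coprod.lift (Subgroup.inclusion hA) (Subgroup.inclusion hK))).range := by
    refine sup_le (fun a ha ↦ ⟨Coprod.inl ⟨a, ha⟩, by simp⟩)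
      (fun k hk ↦ ⟨Coprod.inr ⟨k, hk⟩, by simp⟩)
  obtain ⟨p, hp⟩ := key (h hb)
  exact ⟨p, Subtype.ext hp⟩

theorem exists_extension {A K B : Subgroup G} {hA : A ≤ B} {hK : K ≤ B}
    (h : Function.Bijective
      (Coprod.lift (Subgroup.inclusion hA) (Subgroup.inclusion hK)))
    {M : Type*} [Group M] (f : A →* M) (g : K →* M) :
    ∃ ρ : B →* M, (∀ a, ρ (Subgroup.inclusion hA a) = f a) ∧
      ∀ k, ρ (Subgroup.inclusion hK k) = g k := by
  let e := MulEquiv.ofBijective _ h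
  refine ⟨(Coprod.lift f g).comp e.symm.toMonoidHom, fun a ↦ ?_, fun k ↦ ?_⟩
  · have : e.symm (Subgroup.inclusion hA a) = Coprod.inl a := by
      rw [MulEquiv.symm_apply_eq]; simp [e]
    simp [this]
  · have : e.symm (Subgroup.inclusion hK k) = Coprod.inr k := by
      rw [MulEquiv.symm_apply_eq]; simp [e]
    simp [this]

theorem trans {A B C : Subgroup G} (hAB : IsFreeFactorOf A B) (hBC : IsFreeFactorOf B C) :
    IsFreeFactorOf A C := by
  obtain ⟨hA, K, hK, h⟩ := hAB
  obtain ⟨hB, L, hL, h'⟩ := hBC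
  have hKL : K ⊔ L ≤ C := sup_le (hK.trans hB) hL
  refine ⟨hA.trans hB, K ⊔ L, hKL, ?_, surjective_lift_of_le_sup _ _ ?_⟩
  · obtain ⟨σ, hσA, hσK⟩ := exists_extension h
      (Coprod.inl : A →* Coprod A (K ⊔ L : Subgroup G))
      (Coprod.inr.comp (Subgroup.inclusion le_sup_left))
    obtain ⟨ρ, hρB, hρL⟩ := exists_extension h' σ
      (Coprod.inr.comp (Subgroup.inclusion le_sup_right))
    refine Function.LeftInverse.injective (g := ρ) fun p ↦ ?_
    have hr : ρ.comp (Subgroup.inclusion hKL) = Coprod.inr := by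
      have hle : K ⊔ L ≤ ((ρ.comp (Subgroup.inclusion hKL)).eqLocus Coprod.inr).map
          (K ⊔ L).subtype := by
        refine sup_le (fun k hk ↦ ?_) (fun l hl ↦ ?_)
        · refine ⟨⟨k, Subgroup.mem_sup_left hk⟩, ?_, rfl⟩
          exact (hρB ⟨k, hK hk⟩).trans (hσK ⟨k, hk⟩)
        · refine ⟨⟨l, Subgroup.mem_sup_right hl⟩, ?_, rfl⟩
          exact hρL ⟨l, hl⟩
      ext ⟨x, hx⟩
      obtain ⟨y, hy, hyx⟩ := hle hx
      obtain rfl : y = ⟨x, hx⟩ := Subtype.ext hyx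
      exact hy
    induction p using Coprod.induction_on with
    | inl a =>
      rw [Coprod.lift_apply_inl]
      exact (hρB (Subgroup.inclusion hA a)).trans (hσA a)
    | inr k =>
      rw [Coprod.lift_apply_inr]
      exact DFunLike.congr_fun hr k
    | mul x y hx hy => rw [map_mul, map_mul, hx, hy]
  · refine (le_sup_of_surjective_lift _ _ h'.2).trans (sup_le ?_ (le_sup_right.trans le_sup_right))
    exact (le_sup_of_surjective_lift _ _ h.2).trans (sup_le_sup_left le_sup_left _)

/-- A transversal of the left cosets of `A` whose representatives of the cosets meeting `C` lie in
`C`, and which is built up from these by left multiplication with elements of `C` and `D`. -/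
theorem exists_transversal (C D A : Subgroup G) (hCD : ⊤ ≤ C ⊔ D) :
    ∃ (t : G ⧸ A → G) (d : G ⧸ A → ℕ), (∀ s, (t s : G ⧸ A) = s) ∧ t ((1 : G) : G ⧸ A) = 1 ∧
      (∀ c ∈ C, t (c : G ⧸ A) ∈ C) ∧
      ∀ s, (¬ ∃ c ∈ C, (c : G ⧸ A) = s) →
        ∃ x, (x ∈ C ∨ x ∈ D) ∧ t s = x * t (x⁻¹ • s) ∧ d (x⁻¹ • s) < d s := by
  classical
  have hreach : ∀ s : G ⧸ A, ∃ n, ∃ l : List G,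
      l.length = n ∧ (∀ x ∈ l, x ∈ C ∨ x ∈ D) ∧ (l.prod : G ⧸ A) = s := by
    intro s
    obtain ⟨g, rfl⟩ := QuotientGroup.mk_surjective s
    have hg : g ∈ Subgroup.closure ((C : Set G) ∪ D) := by
      rw [← Subgroup.sup_eq_closure]; exact hCD trivial
    rw [← Subgroup.mem_toSubmonoid, Subgroup.closure_toSubmonoid] at hg
    obtain ⟨l, hl, rfl⟩ := Submonoid.exists_list_of_mem_closure hg
    refine ⟨_, l, rfl, fun x hx ↦ ?_, rfl⟩
    simpa using hl x hx
  let d : G ⧸ A → ℕ := fun s ↦ Nat.find (hreach s)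
  have hpar : ∀ s : G ⧸ A, ∃ x, (¬ ∃ c ∈ C, (c : G ⧸ A) = s) →
      (x ∈ C ∨ x ∈ D) ∧ d (x⁻¹ • s) < d s := by
    intro s
    by_cases hs : ∃ c ∈ C, (c : G ⧸ A) = s
    · exact ⟨1, fun h ↦ (h hs).elim⟩
    obtain ⟨l, hl, hmem, hprod⟩ := Nat.find_spec (hreach s)
    cases l with
    | nil => exact (hs ⟨1, one_mem _, by simpa using hprod⟩).elim
    | cons x l =>
      refine ⟨x, fun _ ↦ ⟨hmem x (by simp), ?_⟩⟩
      have : d (x⁻¹ • s) ≤ l.length := Nat.find_min' _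
        ⟨l, rfl, fun y hy ↦ hmem y (by simp [hy]), by
          rw [← hprod, MulAction.Quotient.smul_coe]; simp⟩
      have hd : l.length + 1 = d s := by simpa using hl
      omega
  have hrep : ∀ s : G ⧸ A, ∃ c, (∃ c ∈ C, (c : G ⧸ A) = s) →
      c ∈ C ∧ (c : G ⧸ A) = s ∧ (s = ((1 : G) : G ⧸ A) → c = 1) := by
    intro s
    by_cases h1 : s = ((1 : G) : G ⧸ A)
    · exact ⟨1, fun _ ↦ ⟨one_mem _, h1.symm, fun _ ↦ rfl⟩⟩
    by_cases hs : ∃ c ∈ C, (c : G ⧸ A) = s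
    · obtain ⟨c, hc, hcs⟩ := hs
      exact ⟨c, fun _ ↦ ⟨hc, hcs, fun h ↦ (h1 h).elim⟩⟩
    · exact ⟨1, fun h ↦ (hs h).elim⟩
  choose x hx using hpar
  choose r hr using hrep
  let F : ∀ s : G ⧸ A, (∀ s', d s' < d s → G) → G := fun s rec ↦
    if h : ∃ c ∈ C, (c : G ⧸ A) = s then r s else x s * rec _ (hx s h).2
  let t : G ⧸ A → G := (measure d).wf.fix F
  have ht : ∀ s, t s = F s fun s' _ ↦ t s' := fun s ↦ WellFounded.fix_eq _ _ _
  have ht_pos : ∀ s, (∃ c ∈ C, (c : G ⧸ A) = s) → t s = r s := fun s h ↦ by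
    rw [ht]; exact dif_pos h
  have ht_neg : ∀ s, (¬ ∃ c ∈ C, (c : G ⧸ A) = s) → t s = x s * t ((x s)⁻¹ • s) := fun s h ↦ by
    rw [ht]; exact dif_neg h
  refine ⟨t, d, fun s ↦ ?_, ?_, fun c hc ↦ ?_,
    fun s hs ↦ ⟨x s, (hx s hs).1, ht_neg s hs, (hx s hs).2⟩⟩
  · induction s using (measure d).wf.induction with
    | _ s ih =>
    by_cases hs : ∃ c ∈ C, (c : G ⧸ A) = s
    · rw [ht_pos s hs]; exact (hr s hs).2.1
    · have := ih _ (hx s hs).2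
      rw [ht_neg s hs, ← smul_eq_mul, ← MulAction.Quotient.smul_coe, this, smul_inv_smul]
  · have h : ∃ c ∈ C, (c : G ⧸ A) = ((1 : G) : G ⧸ A) := ⟨1, one_mem _, rfl⟩
    rw [ht_pos _ h]; exact (hr _ h).2.2 rfl
  · have h : ∃ c' ∈ C, (c' : G ⧸ A) = (c : G ⧸ A) := ⟨c, hc, rfl⟩
    rw [ht_pos _ h]; exact (hr _ h).1

/-- The action on `S × L` defined by an `L`-valued cocycle. -/
def cocyclePerm {Γ S L : Type*} [Group Γ] [MulAction Γ S] [Group L] (c : Γ → S → L)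
    (hone : ∀ s, c 1 s = 1) (hmul : ∀ g h s, c (g * h) s = c g (h • s) * c h s) :
    Γ →* Equiv.Perm (S × L) :=
  letI : MulAction Γ (S × L) :=
    { smul := fun g p ↦ (g • p.1, c g p.1 * p.2)
      one_smul := fun p ↦ Prod.ext (one_smul Γ p.1) (by
        change c 1 p.1 * p.2 = p.2
        rw [hone, one_mul])
      mul_smul := fun g h p ↦ Prod.ext (mul_smul g h p.1) (by
        change c (g * h) p.1 * p.2 = c g (h • p.1) * (c h p.1 * p.2)
        rw [hmul, mul_assoc]) }
  MulAction.toPermHom Γ (S × L)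

theorem cocyclePerm_apply {Γ S L : Type*} [Group Γ] [MulAction Γ S] [Group L] (c : Γ → S → L)
    (hone : ∀ s, c 1 s = 1) (hmul : ∀ g h s, c (g * h) s = c g (h • s) * c h s)
    (g : Γ) (s : S) (l : L) :
    cocyclePerm c hone hmul g (s, l) = (g • s, c g s * l) :=
  rfl

/-- The Kurosh subgroup theorem for the distinguished factor of a subgroup `A`. -/
theorem inf_of_top {C : Subgroup G} (hC : IsFreeFactorOf C ⊤) (A : Subgroup G) :
    IsFreeFactorOf (A ⊓ C) A := by
  classical
  obtain ⟨hCt, D, hDt, hbij⟩ := hC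
  have hCD := le_sup_of_surjective_lift _ _ hbij.2
  obtain ⟨t, d, ht, ht1, htC, hpar⟩ := exists_transversal C D A hCD
  let loop : G → G ⧸ A → G := fun g s ↦ (t (g • s))⁻¹ * g * t s
  let S₀ : Set (G ⧸ A) := {s | ∃ c ∈ C, (c : G ⧸ A) = s}
  have loop_mem : ∀ g s, loop g s ∈ A := fun g s ↦ by
    change (t (g • s))⁻¹ * g * t s ∈ A
    rw [mul_assoc, ← QuotientGroup.eq, ht, ← smul_eq_mul, ← MulAction.Quotient.smul_coe, ht]
  have loop_one : ∀ s, loop 1 s = 1 := fun s ↦ by simp [loop]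
  have loop_mul : ∀ g h s, loop (g * h) s = loop g (h • s) * loop h s := fun g h s ↦ by
    simp only [loop, mul_smul]; group
  have smul_mem : ∀ g ∈ C, ∀ s, g • s ∈ S₀ ↔ s ∈ S₀ := by
    have key : ∀ g ∈ C, ∀ s ∈ S₀, g • s ∈ S₀ := by
      rintro g hg _ ⟨c, hc, rfl⟩
      exact ⟨g * c, mul_mem hg hc, rfl⟩
    refine fun g hg s ↦ ⟨fun h ↦ ?_, key g hg s⟩
    simpa using key g⁻¹ (inv_mem hg) _ h
  have t_mem : ∀ s ∈ S₀, t s ∈ C := by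
    rintro _ ⟨c, hc, rfl⟩
    exact htC c hc
  have loop_mem_inf : ∀ g ∈ C, ∀ s ∈ S₀, loop g s ∈ A ⊓ C := fun g hg s hs ↦
    Subgroup.mem_inf.2 ⟨loop_mem g s,
      mul_mem (mul_mem (inv_mem (t_mem _ ((smul_mem g hg s).2 hs))) hg) (t_mem s hs)⟩
  let E : Set G := {a | ∃ g s, (g ∈ C ∧ s ∉ S₀ ∨ g ∈ D) ∧ loop g s = a}
  let K : Subgroup G := Subgroup.closure E
  have loop_mem_K : ∀ g s, (g ∈ C ∧ s ∉ S₀ ∨ g ∈ D) → loop g s ∈ K := fun g s h ↦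
    Subgroup.subset_closure ⟨g, s, h, rfl⟩
  have hKA : K ≤ A := by
    rw [Subgroup.closure_le]
    rintro _ ⟨g, s, -, rfl⟩
    exact loop_mem g s
  refine ⟨inf_le_left, K, hKA, ?_, surjective_lift_of_le_sup _ _ ?_⟩
  · let L := Coprod (A ⊓ C : Subgroup G) K
    let cC : C → G ⧸ A → L := fun g s ↦
      if hs : s ∈ S₀ then Coprod.inl ⟨loop g s, loop_mem_inf g g.2 s hs⟩
      else Coprod.inr ⟨loop g s, loop_mem_K g s (.inl ⟨g.2, hs⟩)⟩
    let cD : D → G ⧸ A → L := fun g s ↦ Coprod.inr ⟨loop g s, loop_mem_K g s (.inr g.2)⟩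
    have cC_one : ∀ s, cC 1 s = 1 := fun s ↦ by
      by_cases hs : s ∈ S₀
      · simp only [cC, dif_pos hs]
        rw [← map_one Coprod.inl]; congr 1; exact Subtype.ext (loop_one s)
      · simp only [cC, dif_neg hs]
        rw [← map_one Coprod.inr]; congr 1; exact Subtype.ext (loop_one s)
    have cC_mul : ∀ g h s, cC (g * h) s = cC g (h • s) * cC h s := fun g h s ↦ by
      have hiff : h • s ∈ S₀ ↔ s ∈ S₀ := smul_mem h h.2 s
      by_cases hs : s ∈ S₀
      · simp only [cC, dif_pos hs, dif_pos (hiff.2 hs)]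
        rw [← map_mul]; congr 1; exact Subtype.ext (loop_mul g h s)
      · simp only [cC, dif_neg hs, dif_neg (mt hiff.1 hs)]
        rw [← map_mul]; congr 1; exact Subtype.ext (loop_mul g h s)
    have cD_one : ∀ s, cD 1 s = 1 := fun s ↦ by
      simp only [cD]
      rw [← map_one Coprod.inr]; congr 1; exact Subtype.ext (loop_one s)
    have cD_mul : ∀ g h s, cD (g * h) s = cD g (h • s) * cD h s := fun g h s ↦ by
      simp only [cD]
      rw [← map_mul]; congr 1; exact Subtype.ext (loop_mul g h s)
    obtain ⟨ρ', hρC', hρD'⟩ := exists_extension hbij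
      (cocyclePerm cC cC_one cC_mul) (cocyclePerm cD cD_one cD_mul)
    let ρ : G →* Equiv.Perm ((G ⧸ A) × L) := ρ'.comp Subgroup.topEquiv.symm.toMonoidHom
    have hρC : ∀ g (hg : g ∈ C) s (hs : s ∈ S₀) l,
        ρ g (s, l) = (g • s, Coprod.inl ⟨loop g s, loop_mem_inf g hg s hs⟩ * l) := by
      intro g hg s hs l
      have : ρ g = cocyclePerm cC cC_one cC_mul ⟨g, hg⟩ := hρC' ⟨g, hg⟩
      rw [this, cocyclePerm_apply]
      simp only [cC, dif_pos hs]
      rfl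
    have hρE : ∀ g s (h : g ∈ C ∧ s ∉ S₀ ∨ g ∈ D) l,
        ρ g (s, l) = (g • s, Coprod.inr ⟨loop g s, loop_mem_K g s h⟩ * l) := by
      rintro g s (⟨hg, hs⟩ | hg) l
      · have : ρ g = cocyclePerm cC cC_one cC_mul ⟨g, hg⟩ := hρC' ⟨g, hg⟩
        rw [this, cocyclePerm_apply]
        simp only [cC, dif_neg hs]
        rfl
      · have : ρ g = cocyclePerm cD cD_one cD_mul ⟨g, hg⟩ := hρD' ⟨g, hg⟩
        rw [this, cocyclePerm_apply]
        rfl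
    have one_mem_S₀ : ((1 : G) : G ⧸ A) ∈ S₀ := ⟨1, one_mem _, rfl⟩
    have smul_base : ∀ g : G, g • ((1 : G) : G ⧸ A) = g := fun g ↦ by
      rw [MulAction.Quotient.smul_coe, smul_eq_mul, mul_one]
    have hρt : ∀ s l, ρ (t s) (((1 : G) : G ⧸ A), l) = (s, l) := by
      intro s l
      induction s using (measure d).wf.induction with
      | _ s ih =>
      by_cases hs : s ∈ S₀
      · rw [hρC _ (t_mem s hs) _ one_mem_S₀]
        have h1 : t s • ((1 : G) : G ⧸ A) = s := by rw [smul_base, ht]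
        have h2 : loop (t s) ((1 : G) : G ⧸ A) = 1 := by simp only [loop, h1, ht1]; group
        refine Prod.ext h1 ?_
        have : (⟨loop (t s) ((1 : G) : G ⧸ A), loop_mem_inf _ (t_mem s hs) _ one_mem_S₀⟩ :
          (A ⊓ C : Subgroup G)) = 1 := Subtype.ext h2
        simp only [this, map_one, one_mul]
      · obtain ⟨x, hx, hts, hlt⟩ := hpar s hs
        have hx' : x ∈ C ∧ x⁻¹ • s ∉ S₀ ∨ x ∈ D := by
          rcases hx with hx | hx
          · exact .inl ⟨hx, mt (smul_mem _ (inv_mem hx) s).1 hs⟩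
          · exact .inr hx
        have h2 : loop x (x⁻¹ • s) = 1 := by
          simp only [loop, smul_inv_smul, hts]; group
        rw [hts, map_mul, Equiv.Perm.mul_apply, ih _ hlt, hρE x _ hx']
        refine Prod.ext (smul_inv_smul x s) ?_
        have : (⟨loop x (x⁻¹ • s), loop_mem_K _ _ hx'⟩ : K) = 1 := Subtype.ext h2
        simp only [this, map_one, one_mul]
    have hρK : ∀ (k : G) (hk : k ∈ K) l, ρ k (((1 : G) : G ⧸ A), l) =
        (((1 : G) : G ⧸ A), Coprod.inr ⟨k, hk⟩ * l) := by
      intro k hk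
      induction hk using Subgroup.closure_induction with
      | mem a ha =>
        intro l
        obtain ⟨g, s, h, rfl⟩ := ha
        change ρ ((t (g • s))⁻¹ * g * t s) _ = _
        rw [map_mul, map_mul, Equiv.Perm.mul_apply, Equiv.Perm.mul_apply, hρt, hρE g s h, map_inv,
          Equiv.Perm.inv_eq_iff_eq, hρt]
      | one =>
        intro l
        rw [map_one, Equiv.Perm.one_apply]
        exact Prod.ext rfl ((one_mul l).symm.trans
          (congrArg (· * l) (map_one (Coprod.inr : K →* L)).symm))
      | mul a b ha hb iha ihb =>
        intro l
        rw [map_mul, Equiv.Perm.mul_apply, ihb, iha, ← mul_assoc, ← map_mul]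
        rfl
      | inv a ha iha =>
        intro l
        rw [map_inv, Equiv.Perm.inv_eq_iff_eq, iha, ← mul_assoc, ← map_mul]
        refine Prod.ext rfl ?_
        have : (⟨a, ha⟩ * ⟨a⁻¹, inv_mem ha⟩ : K) = 1 := Subtype.ext (mul_inv_cancel a)
        exact ((congrArg (fun z : K ↦ (Coprod.inr z : L) * l) this).trans (by simp)).symm
    have hρ : ∀ p l : L,
        ρ (Coprod.lift (Subgroup.inclusion inf_le_left) (Subgroup.inclusion hKA) p : A)
          (((1 : G) : G ⧸ A), l) = (((1 : G) : G ⧸ A), p * l) := by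
      intro p
      induction p using Coprod.induction_on with
      | inl a =>
        intro l
        rw [Coprod.lift_apply_inl, Subgroup.coe_inclusion, hρC _ a.2.2 _ one_mem_S₀]
        have h1 : (a : G) • ((1 : G) : G ⧸ A) = ((1 : G) : G ⧸ A) := by
          rw [smul_base, eq_comm, QuotientGroup.eq]; simpa using a.2.1
        refine Prod.ext h1 ?_
        have h2 : (⟨loop a ((1 : G) : G ⧸ A), loop_mem_inf _ a.2.2 _ one_mem_S₀⟩ :
            (A ⊓ C : Subgroup G)) = a := Subtype.ext (by simp only [loop, h1, ht1]; group)
        simp only [h2]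
      | inr k =>
        intro l
        rw [Coprod.lift_apply_inr, Subgroup.coe_inclusion, hρK _ k.2]
      | mul x y hx hy =>
        intro l
        rw [map_mul, Subgroup.coe_mul, map_mul, Equiv.Perm.mul_apply, hy, hx, mul_assoc]
    intro p q hpq
    have h := (hρ p 1).symm.trans ((by rw [hpq] : _ = _).trans (hρ q 1))
    simpa using congrArg Prod.snd h
  · have loop_mem_sup : ∀ g s, loop g s ∈ A ⊓ C ⊔ K := by
      intro g
      have hg : g ∈ Subgroup.closure ((C : Set G) ∪ D) := by
        rw [← Subgroup.sup_eq_closure]; exact hCD trivial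
      induction hg using Subgroup.closure_induction with
      | mem g hg =>
        intro s
        rcases hg with hg | hg
        · by_cases hs : s ∈ S₀
          · exact Subgroup.mem_sup_left (loop_mem_inf g hg s hs)
          · exact Subgroup.mem_sup_right (loop_mem_K g s (.inl ⟨hg, hs⟩))
        · exact Subgroup.mem_sup_right (loop_mem_K g s (.inr hg))
      | one => intro s; rw [loop_one]; exact one_mem _
      | mul g h _ _ ihg ihh => intro s; rw [loop_mul]; exact mul_mem (ihg _) (ihh _)
      | inv g _ ih =>
        intro s
        have : loop g⁻¹ s = (loop g (g⁻¹ • s))⁻¹ := by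
          simp only [loop, smul_inv_smul]; group
        rw [this]; exact inv_mem (ih _)
    intro a ha
    have h1 : a • ((1 : G) : G ⧸ A) = ((1 : G) : G ⧸ A) := by
      rw [MulAction.Quotient.smul_coe, eq_comm, QuotientGroup.eq]; simpa using ha
    have : loop a ((1 : G) : G ⧸ A) = a := by simp only [loop, h1, ht1]; group
    rw [← this]
    exact loop_mem_sup _ _

theorem refl (A : Subgroup G) : IsFreeFactorOf A A := by
  refine ⟨le_rfl, ⊥, bot_le, ?_, surjective_lift_of_le_sup _ _ le_sup_left⟩
  refine Function.LeftInverse.injective (g := Coprod.inl) fun p ↦ ?_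
  induction p using Coprod.induction_on with
  | inl a => rfl
  | inr k =>
    obtain rfl := Subsingleton.elim k 1
    simp
  | mul x y hx hy => rw [map_mul, map_mul, hx, hy]

theorem groupFG {A B : Subgroup G} (h : IsFreeFactorOf A B) [Group.FG B] : Group.FG A := by
  obtain ⟨hA, K, hK, h⟩ := h
  obtain ⟨ρ, hρ, -⟩ := exists_extension h (MonoidHom.id A) (1 : K →* A)
  exact Group.fg_of_surjective (f := ρ) fun a ↦ ⟨_, hρ a⟩

end IsFreeFactorOf

theorem Group.FG.finite_monoidHom {G M : Type*} [Group G] [Group M] [Finite M] [Group.FG G] :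
    Finite (G →* M) := by
  obtain ⟨S, hS⟩ := Group.FG.out (G := G)
  refine Finite.of_injective (fun (f : G →* M) (s : S) ↦ f s) fun f g hfg ↦ ?_
  exact MonoidHom.eq_of_eqOn_dense hS fun s hs ↦ congrFun hfg ⟨s, hs⟩

theorem IsFreeGroup.exists_monoidHom_ne_one {G M : Type*} [Group G] [Group M] [IsFreeGroup G]
    [Nontrivial G] [Nontrivial M] : ∃ f : G →* M, f ≠ 1 := by
  obtain ⟨m, hm⟩ := exists_ne (1 : M)
  have hne : Nonempty (IsFreeGroup.Generators G) := by
    by_contra h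
    rw [not_nonempty_iff] at h
    exact not_subsingleton G (IsFreeGroup.toFreeGroup G).toEquiv.subsingleton
  obtain ⟨x⟩ := hne
  refine ⟨IsFreeGroup.lift fun _ ↦ m, fun h ↦ hm ?_⟩
  simpa using DFunLike.congr_fun h (IsFreeGroup.of x)

theorem IsFreeFactorOf.card_monoidHom_lt {G M : Type*} [Group G] [IsFreeGroup G] [Group M]
    [Nontrivial M] [Finite M] {A B : Subgroup G} [Group.FG B] (h : IsFreeFactorOf A B)
    (hne : A ≠ B) : Nat.card (A →* M) < Nat.card (B →* M) := by
  obtain ⟨hA, K, hK, h⟩ := h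
  have : Finite (B →* M) := Group.FG.finite_monoidHom
  have : Nontrivial K := by
    rw [Subgroup.nontrivial_iff_ne_bot]
    rintro rfl
    exact hne (le_antisymm hA (by simpa using le_sup_of_surjective_lift _ _ h.2))
  obtain ⟨χ, hχ⟩ := IsFreeGroup.exists_monoidHom_ne_one (G := K) (M := M)
  let res : (B →* M) → (A →* M) := fun f ↦ f.comp (Subgroup.inclusion hA)
  have hsurj : Function.Surjective res := fun f ↦ by
    obtain ⟨ρ, hρ, -⟩ := exists_extension h f (1 : K →* M)
    exact ⟨ρ, MonoidHom.ext hρ⟩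
  refine (Nat.card_le_card_of_surjective res hsurj).lt_of_ne fun hcard ↦ hχ ?_
  have hinj : Function.Injective res :=
    ((Nat.bijective_iff_surjective_and_card res).2 ⟨hsurj, hcard.symm⟩).1
  obtain ⟨ρ, hρA, hρK⟩ := exists_extension h (1 : A →* M) χ
  have : ρ = 1 := hinj (MonoidHom.ext hρA)
  ext k
  rw [← hρK, this]
  rfl

/-- Every finitely generated subgroup `H` of `F_N` is contained in a smallest free factor
`Fill(H)`: the intersection of all free factors of `F_N` containing `H` is itself a free
factor of `F_N` containing `H` (hence is the unique smallest such free factor). -/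
theorem exists_smallest_freeFactor {N : ℕ} (H : Subgroup (FreeGroup (Fin N))) (hH : H.FG) :
    IsFreeFactorOf (sInf {F : Subgroup (FreeGroup (Fin N)) | IsFreeFactorOf F ⊤ ∧ H ≤ F}) ⊤ ∧
      H ≤ sInf {F : Subgroup (FreeGroup (Fin N)) | IsFreeFactorOf F ⊤ ∧ H ≤ F} := by
  have : Group.FG (⊤ : Subgroup (FreeGroup (Fin N))) :=
    Group.fg_of_surjective (f := (Subgroup.topEquiv (G := FreeGroup (Fin N))).symm.toMonoidHom)
      (Subgroup.topEquiv (G := FreeGroup (Fin N))).symm.surjective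
  let μ : Subgroup (FreeGroup (Fin N)) → ℕ := fun F ↦ Nat.card (F →* Multiplicative (ZMod 2))
  obtain ⟨A, ⟨hA, hHA⟩, hmin⟩ := (measure μ).wf.has_min
    {F : Subgroup (FreeGroup (Fin N)) | IsFreeFactorOf F ⊤ ∧ H ≤ F} ⟨⊤, .refl ⊤, le_top⟩
  have hle : ∀ C, IsFreeFactorOf C ⊤ → H ≤ C → A ≤ C := by
    intro C hC hHC
    have hAC := hC.inf_of_top A
    have := hA.groupFG
    by_contra hn
    exact hmin (A ⊓ C) ⟨hAC.trans hA, le_inf hHA hHC⟩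
      (hAC.card_monoidHom_lt fun h ↦ hn (inf_eq_left.1 h))
  have heq : sInf {F : Subgroup (FreeGroup (Fin N)) | IsFreeFactorOf F ⊤ ∧ H ≤ F} = A :=
    le_antisymm (sInf_le ⟨hA, hHA⟩) (le_sInf fun C hC ↦ hle C hC.1 hC.2)
  rw [heq]
  exact ⟨hA, hHA⟩
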